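/- Let (H, A, ‖·‖♯) be a compressed sensing space with bound L and Φ : H → ℝ^M linear. Let κ ∈ (0,1), λ > 0, x♮ ∈ H, and ω ∈ ℝ^M with ‖Φᵀω‖♦ ≤ κλ. If x* minimizes x ↦ (1/2)‖Φx − (Φx♮ + ω)‖₂² + λ‖x‖♯ and z = x* − x♮, then for every a ∈ A, ‖z‖♯ ≤ (2/(1−κ))‖x♮ − a‖♯ + (2L/(1−κ))‖z‖₂. -/

import Mathlib

noncomputable section

open scoped RealInnerProductSpace

variable {H : Type*} [NormedAddCommGroup H] [InnerProductSpace ℝ H] [FiniteDimensional ℝ H]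

/-- `sharp` is a norm on `H`. -/
structure IsNormOn (sharp : H → ℝ) : Prop where
  triangle : ∀ x y : H, sharp (x + y) ≤ sharp x + sharp y
  smul_eq : ∀ (c : ℝ) (x : H), sharp (c • x) = |c| * sharp x
  eq_zero_of : ∀ x : H, sharp x = 0 → x = 0

/-- The dual norm of `sharp`: `‖u‖♦ = sup {|⟨u,v⟩| : ‖v‖♯ ≤ 1}`. -/
def dualNorm (sharp : H → ℝ) (u : H) : ℝ :=
  sSup {r : ℝ | ∃ v : H, sharp v ≤ 1 ∧ r = |⟪u, v⟫|}

/-- The subdifferential of `f` at `x`. -/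
def subdiff (f : H → ℝ) (x : H) : Set H :=
  {u : H | ∀ y : H, f y ≥ f x + ⟪u, y - x⟫}

/-- `(H, A, sharp)` is a compressed sensing space with bound `L`. -/
structure IsCSSpace (A : Set H) (sharp : H → ℝ) (L : ℝ) : Prop where
  zero_mem : (0 : H) ∈ A
  decomp : ∀ a ∈ A, ∀ v : H, ∃ z₁ z₂ : H, v = z₁ + z₂ ∧
    sharp (a + z₁) = sharp a + sharp z₁ ∧ sharp z₂ ≤ L * ‖v‖

/-- `Φ` satisfies the `(ρ, α)`-robust width property over the unit `sharp`-ball. -/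
def RobustWidth {M : ℕ} (Φ : H →ₗ[ℝ] EuclideanSpace ℝ (Fin M)) (sharp : H → ℝ)
    (ρ α : ℝ) : Prop :=
  ∀ x : H, ‖Φ x‖ < α * ‖x‖ → ‖x‖ ≤ ρ * sharp x

/-- On a finite-dimensional real space, every linear functional is bounded with respect to every
norm. -/
theorem exists_abs_le_mul_of_norm {E : Type*} [AddCommGroup E] [Module ℝ E]
    [FiniteDimensional ℝ E] (p : Seminorm ℝ E) (hp : ∀ x, p x = 0 → x = 0) (f : E →ₗ[ℝ] ℝ) :
    ∃ C : ℝ, 0 ≤ C ∧ ∀ v, |f v| ≤ C * p v := by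
  let _ : Norm E := ⟨p⟩
  have core : NormedSpace.Core ℝ E :=
    { norm_nonneg := apply_nonneg p
      norm_smul := map_smul_eq_mul p
      norm_triangle := map_add_le_add p
      norm_eq_zero_iff := fun x => ⟨hp x, fun h => h ▸ map_zero p⟩ }
  let _ : NormedAddCommGroup E := NormedAddCommGroup.ofCore core
  let _ : NormedSpace ℝ E := NormedSpace.ofCore core
  exact ⟨‖f.toContinuousLinearMap‖, norm_nonneg _, fun v => f.toContinuousLinearMap.le_opNorm v⟩

namespace IsNormOn

variable {sharp : H → ℝ}

/-- A function satisfying `IsNormOn`, bundled as a seminorm. -/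
def toSeminorm (hs : IsNormOn sharp) : Seminorm ℝ H :=
  Seminorm.of sharp hs.triangle hs.smul_eq

theorem nonneg (hs : IsNormOn sharp) (x : H) : 0 ≤ sharp x :=
  apply_nonneg hs.toSeminorm x

theorem bddAbove_dualNorm (hs : IsNormOn sharp) (u : H) :
    BddAbove {r : ℝ | ∃ v : H, sharp v ≤ 1 ∧ r = |⟪u, v⟫|} := by
  obtain ⟨C, hC, h⟩ := exists_abs_le_mul_of_norm hs.toSeminorm hs.eq_zero_of (innerₗ H u)
  refine ⟨C, ?_⟩
  rintro r ⟨v, hv, rfl⟩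
  exact (h v).trans (mul_le_of_le_one_right hC hv)

/-- The duality inequality for `dualNorm`. -/
theorem abs_inner_le (hs : IsNormOn sharp) (u v : H) :
    |⟪u, v⟫| ≤ dualNorm sharp u * sharp v := by
  rcases (hs.nonneg v).eq_or_lt with h0 | hpos
  · rw [← h0, hs.eq_zero_of v h0.symm]
    simp
  · have h : |⟪u, (sharp v)⁻¹ • v⟫| ≤ dualNorm sharp u :=
      le_csSup (hs.bddAbove_dualNorm u)
        ⟨(sharp v)⁻¹ • v, by rw [hs.smul_eq, abs_of_pos (inv_pos.2 hpos),
          inv_mul_cancel₀ hpos.ne'], rfl⟩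
    rwa [real_inner_smul_right, abs_mul, abs_of_pos (inv_pos.2 hpos),
      inv_mul_le_iff₀ hpos, mul_comm] at h

end IsNormOn

theorem lasso_step2 {M : ℕ} (sharp : H → ℝ) (hs : IsNormOn sharp)
    (A : Set H) (L : ℝ) (hcs : IsCSSpace A sharp L)
    (Φ : H →ₗ[ℝ] EuclideanSpace ℝ (Fin M))
    (κ : ℝ) (hκ : κ ∈ Set.Ioo (0 : ℝ) 1)
    (lam : ℝ) (hlam : 0 < lam)
    (xnat : H) (ω : EuclideanSpace ℝ (Fin M))
    (hω : dualNorm sharp ((LinearMap.adjoint Φ) ω) ≤ κ * lam)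
    (xstar : H)
    (hmin : ∀ x : H,
      (1 / 2) * ‖Φ xstar - (Φ xnat + ω)‖ ^ 2 + lam * sharp xstar ≤
        (1 / 2) * ‖Φ x - (Φ xnat + ω)‖ ^ 2 + lam * sharp x)
    (z : H) (hz : z = xstar - xnat) :
    ∀ a ∈ A,
      sharp z ≤ (2 / (1 - κ)) * sharp (xnat - a) + (2 * L / (1 - κ)) * ‖z‖ := by
  intro a ha
  have neg (x : H) : sharp (-x) = sharp x := map_neg_eq_map hs.toSeminorm x
  have hcompare : sharp xstar ≤ sharp xnat + κ * sharp z := by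
    have hm := hmin xnat
    rw [show Φ xstar - (Φ xnat + ω) = Φ z - ω by rw [hz, map_sub]; abel,
      show Φ xnat - (Φ xnat + ω) = -ω by abel, norm_neg, norm_sub_sq_real,
      real_inner_comm, ← LinearMap.adjoint_inner_left] at hm
    have hd := (le_abs_self _).trans (hs.abs_inner_le (LinearMap.adjoint Φ ω) z)
    have hk := mul_le_mul_of_nonneg_right hω (hs.nonneg z)
    refine le_of_mul_le_mul_left ?_ hlam
    nlinarith [sq_nonneg ‖Φ z‖]
  obtain ⟨z₁, z₂, hzz, hadd, hz₂⟩ := hcs.decomp a ha z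
  have h₁ : sharp (a + z₁) ≤ sharp xstar + sharp (xnat - a) + sharp z₂ := by
    have e : a + z₁ = xstar + -(xnat - a) + -z₂ := by
      rw [eq_sub_of_add_eq hzz.symm, hz]; abel
    rw [e, ← neg (xnat - a), ← neg z₂]
    linarith [hs.triangle (xstar + -(xnat - a)) (-z₂), hs.triangle xstar (-(xnat - a))]
  have h₂ : sharp xnat ≤ sharp a + sharp (xnat - a) := by
    simpa using hs.triangle a (xnat - a)
  have h₃ : sharp z ≤ sharp z₁ + sharp z₂ := hzz ▸ hs.triangle z₁ z₂
  rw [div_mul_eq_mul_div, div_mul_eq_mul_div, ← add_div, le_div_iff₀ (sub_pos.2 hκ.2)]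
  linarith
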